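/- Let Y be a Banach space, 0 < α ≤ 1, and C a nonempty set of real functions on Y which is bounded in the C^{1,α}_b-sense: there is r > 0 such that every φ ∈ C is bounded by r, r-Lipschitz, continuously Fréchet differentiable with α-Hölder differential of constant at most r; assume also C is relatively compact for the norm ‖φ‖_{1,α} = max(‖φ‖_∞, Lip(φ), Hölder_α(φ')). Let Ω ⊂ Y be open, f : Ω → ℝ Gateaux differentiable at x̂ ∈ Ω, and suppose x̂ maximizes f over { x ∈ Ω : φ(x) ≥ 0 for all φ ∈ C }. Then either d_Gf(x̂) = 0, or there exist (λ*, β*) ∈ ℝ₊ × ℝ₊ with (λ*, β*) ≠ (0,0) and ψ in the ‖·‖_{1,α}-closed convex hull of C such that λ* d_Gf(x̂) + β* ψ'(x̂) = 0 and ψ(x̂) = 0. If moreover 0 ∉ { φ'(x̂) : φ(x̂) = 0, φ in the ‖·‖_{1,α}-closed convex hull of C }, one can take λ* = 1. -/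

import Mathlib

open Topology Filter Set

noncomputable section

section Defs

variable {E : Type*} [AddCommGroup E] [Module ℝ E] [TopologicalSpace E]

/-- The canonical map from the topological dual of `E` to the weak-star dual. -/
def toWD (φ : E →L[ℝ] ℝ) : WeakDual ℝ E := φ

/-- The weak-star closed convex hull of a set of continuous linear functionals. -/
def wcch (B : Set (E →L[ℝ] ℝ)) : Set (WeakDual ℝ E) :=
  closure (convexHull ℝ (toWD '' B))

/-- `f` is Gateaux differentiable at `x` with Gateaux-differential `f'`. -/
def HasGateauxAt (f : E → ℝ) (f' : E →L[ℝ] ℝ) (x : E) : Prop :=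
  ∀ v : E, Tendsto (fun t : ℝ => (f (x + t • v) - f x - t * f' v) / t) (𝓝[>] 0) (𝓝 0)

/-- The family `C` is equi-Gateaux differentiable at `x`, with differentials given by `D`. -/
def EquiGateauxAt (C : Set (E → ℝ)) (D : (E → ℝ) → E →L[ℝ] ℝ) (x : E) : Prop :=
  (∀ φ ∈ C, HasGateauxAt φ (D φ) x) ∧
  ∀ v : E, ∀ ε : ℝ, 0 < ε → ∃ δ : ℝ, 0 < δ ∧ ∀ t : ℝ, 0 < t → t < δ →
    ∀ φ ∈ C, |(φ (x + t • v) - φ x - t * (D φ) v) / t| ≤ ε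

/-- The family `C` is equi-lower semicontinuous at `x`. -/
def EquiLscAt (C : Set (E → ℝ)) (x : E) : Prop :=
  ∀ ε : ℝ, 0 < ε → ∃ O ∈ 𝓝 x, ∀ y ∈ O, ∀ φ ∈ C, φ y - φ x > -ε

/-- `[C]^× = {x ∈ E : φ(x) ≥ 0 for all φ ∈ C}`. -/
def polarSet (C : Set (E → ℝ)) : Set E := {x | ∀ φ ∈ C, 0 ≤ φ x}

/-- The multiplier set `T_C(x̂)`. -/
def multSet (C : Set (E → ℝ)) (D : (E → ℝ) → E →L[ℝ] ℝ) (x : E) : Set (WeakDual ℝ E) :=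
  ⋂ n ∈ {n : ℕ | 1 ≤ n}, wcch (D '' {φ | φ ∈ C ∧ φ x ∈ Icc (0:ℝ) (1/(n:ℝ))})

/-- `F` is weak-admissible at `x ∈ F`, determined by `C` (with differentials `D`). -/
def WeakAdmissibleAt (F : Set E) (C : Set (E → ℝ)) (D : (E → ℝ) → E →L[ℝ] ℝ) (x : E) : Prop :=
  x ∈ F ∧ C.Nonempty ∧ F = polarSet C ∧ EquiGateauxAt C D x ∧
    ({φ | φ ∈ C ∧ φ x ≠ 0} = ∅ ∨ EquiLscAt {φ | φ ∈ C ∧ φ x ≠ 0} x) ∧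
    IsCompact (wcch (D '' C))

end Defs

section NormedDefs

variable {Y : Type*} [NormedAddCommGroup Y] [NormedSpace ℝ Y]

/-- `A` is admissible at `x ∈ A`, determined by `C` (with differentials `D`). -/
def AdmissibleAt (A : Set Y) (C : Set (Y → ℝ)) (D : (Y → ℝ) → Y →L[ℝ] ℝ) (x : Y) : Prop :=
  x ∈ A ∧ C.Nonempty ∧ A = polarSet C ∧ EquiGateauxAt C D x ∧
    (∃ r : NNReal, ∃ ε : ℝ, 0 < ε ∧ ∀ φ ∈ C, LipschitzOnWith r φ (Metric.ball x ε)) ∧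
    toWD (0 : Y →L[ℝ] ℝ) ∉ wcch (D '' C)

/-- The recession cone of a set. -/
def recCone (K : Set Y) : Set Y := {v | ∀ l : ℝ, 0 < l → ∀ x ∈ K, x + l • v ∈ K}

/-- The barrier cone of `K`: functionals bounded above on `K`. -/
def barCone (K : Set Y) : Set (Y →L[ℝ] ℝ) := {φ | BddAbove (φ '' K)}

/-- The dual positive cone `A*`. -/
def posDualCone (A : Set Y) : Set (Y →L[ℝ] ℝ) := {φ | ∀ y ∈ A, 0 ≤ φ y}

end NormedDefs

section Stmt15

variable {Y : Type*} [NormedAddCommGroup Y] [NormedSpace ℝ Y]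

/-- The sup seminorm `‖f‖_∞`. -/
noncomputable def supAbs (f : Y → ℝ) : ℝ := ⨆ x : Y, |f x|

/-- The Lipschitz seminorm `‖f‖_L`. -/
noncomputable def lipSemi (f : Y → ℝ) : ℝ := ⨆ x : Y × Y, |f x.1 - f x.2| / ‖x.1 - x.2‖

/-- The `α`-Hölder seminorm of a dual-valued map. -/
noncomputable def holderSemi (α : ℝ) (g : Y → Y →L[ℝ] ℝ) : ℝ :=
  ⨆ x : Y × Y, ‖g x.1 - g x.2‖ / ‖x.1 - x.2‖ ^ α

/-- The `C^{1,α}_b`-norm distance between two pairs (function, derivative map). -/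
noncomputable def d1a (α : ℝ) (p q : (Y → ℝ) × (Y → Y →L[ℝ] ℝ)) : ℝ :=
  max (supAbs fun x => p.1 x - q.1 x)
    (max (lipSemi fun x => p.1 x - q.1 x) (holderSemi α fun x => p.2 x - q.2 x))

/-- Elements of `C^{1,α}_b(Y)`, modelled as pairs `(φ, φ')`: bounded, Lipschitz, everywhere
Fréchet differentiable with `α`-Hölder differential. -/
def C1aSet (α : ℝ) : Set ((Y → ℝ) × (Y → Y →L[ℝ] ℝ)) :=
  {p | (∃ M : ℝ, ∀ x : Y, |p.1 x| ≤ M) ∧ (∃ L : NNReal, LipschitzWith L p.1) ∧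
       (∀ x : Y, HasFDerivAt p.1 (p.2 x) x) ∧ Continuous p.2 ∧
       ∃ H : ℝ, 0 ≤ H ∧ ∀ x₁ x₂ : Y, ‖p.2 x₁ - p.2 x₂‖ ≤ H * ‖x₁ - x₂‖ ^ α}

/-- The `C^{1,α}_b`-norm of a pair (function, derivative map). -/
def c1aNorm (α : ℝ) (p : (Y → ℝ) × (Y → Y →L[ℝ] ℝ)) : ℝ :=
  max (supAbs p.1) (max (lipSemi p.1) (holderSemi α p.2))

theorem d1a_eq_c1aNorm_sub (α : ℝ) (p q : (Y → ℝ) × (Y → Y →L[ℝ] ℝ)) :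
    d1a α p q = c1aNorm α (p - q) := rfl

theorem c1aNorm_nonneg (α : ℝ) (p : (Y → ℝ) × (Y → Y →L[ℝ] ℝ)) : 0 ≤ c1aNorm α p :=
  le_max_of_le_left (Real.iSup_nonneg fun _ => abs_nonneg _)

theorem c1aNorm_le {α c : ℝ} {p : (Y → ℝ) × (Y → Y →L[ℝ] ℝ)} (hc : 0 ≤ c)
    (h₀ : ∀ x, |p.1 x| ≤ c) (h₁ : ∀ x y, |p.1 x - p.1 y| ≤ c * ‖x - y‖)
    (h₂ : ∀ x y, ‖p.2 x - p.2 y‖ ≤ c * ‖x - y‖ ^ α) : c1aNorm α p ≤ c :=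
  max_le (Real.iSup_le h₀ hc) (max_le
    (Real.iSup_le (fun x => div_le_of_le_mul₀ (norm_nonneg _) hc (h₁ x.1 x.2)) hc)
    (Real.iSup_le (fun x => div_le_of_le_mul₀ (by positivity) hc (h₂ x.1 x.2)) hc))

theorem abs_le_c1aNorm {α : ℝ} {p : (Y → ℝ) × (Y → Y →L[ℝ] ℝ)} (hp : p ∈ C1aSet α) (x : Y) :
    |p.1 x| ≤ c1aNorm α p := by
  obtain ⟨⟨M, hM⟩, -⟩ := hp
  exact (le_ciSup (f := fun x => |p.1 x|) ⟨M, forall_mem_range.2 hM⟩ x).trans (le_max_left _ _)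

theorem abs_sub_le_c1aNorm_mul {α : ℝ} {p : (Y → ℝ) × (Y → Y →L[ℝ] ℝ)} (hp : p ∈ C1aSet α)
    (x y : Y) : |p.1 x - p.1 y| ≤ c1aNorm α p * ‖x - y‖ := by
  obtain ⟨-, ⟨L, hL⟩, -⟩ := hp
  rcases eq_or_ne x y with rfl | hxy
  · simp
  have hbdd : BddAbove (range fun x : Y × Y => |p.1 x.1 - p.1 x.2| / ‖x.1 - x.2‖) :=
    ⟨L, forall_mem_range.2 fun x => div_le_of_le_mul₀ (norm_nonneg _) L.2
      (by simpa [Real.norm_eq_abs] using hL.norm_sub_le x.1 x.2)⟩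
  rw [← div_le_iff₀ (norm_pos_iff.2 (sub_ne_zero.2 hxy))]
  exact (le_ciSup hbdd (x, y)).trans ((le_max_left _ _).trans (le_max_right _ _))

theorem norm_sub_le_c1aNorm_mul {α : ℝ} {p : (Y → ℝ) × (Y → Y →L[ℝ] ℝ)} (hp : p ∈ C1aSet α)
    (x y : Y) : ‖p.2 x - p.2 y‖ ≤ c1aNorm α p * ‖x - y‖ ^ α := by
  obtain ⟨-, -, -, -, H, hH₀, hH⟩ := hp
  rcases eq_or_ne x y with rfl | hxy
  · simpa using mul_nonneg (c1aNorm_nonneg α p) (Real.rpow_nonneg le_rfl α)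
  have hbdd : BddAbove (range fun x : Y × Y => ‖p.2 x.1 - p.2 x.2‖ / ‖x.1 - x.2‖ ^ α) :=
    ⟨H, forall_mem_range.2 fun x => div_le_of_le_mul₀ (by positivity) hH₀ (hH x.1 x.2)⟩
  rw [← div_le_iff₀ (Real.rpow_pos_of_pos (norm_pos_iff.2 (sub_ne_zero.2 hxy)) α)]
  exact (le_ciSup hbdd (x, y)).trans ((le_max_right _ _).trans (le_max_right _ _))

theorem norm_deriv_le_c1aNorm {α : ℝ} {p : (Y → ℝ) × (Y → Y →L[ℝ] ℝ)} (hp : p ∈ C1aSet α)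
    (x : Y) : ‖p.2 x‖ ≤ c1aNorm α p :=
  (hp.2.2.1 x).le_of_lip' (c1aNorm_nonneg α p)
    (.of_forall fun y => abs_sub_le_c1aNorm_mul hp y x)

/-- The space `C^{1,α}_b(Y)` as a submodule of the space of pairs of maps. -/
def c1aSubmodule (Y : Type*) [NormedAddCommGroup Y] [NormedSpace ℝ Y] (α : ℝ) :
    Submodule ℝ ((Y → ℝ) × (Y → Y →L[ℝ] ℝ)) where
  carrier := C1aSet α
  zero_mem' := ⟨⟨0, by simp⟩, ⟨0, LipschitzWith.const _⟩, fun x => hasFDerivAt_const _ _,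
    continuous_const, 0, le_rfl, by simp⟩
  add_mem' := by
    rintro p q ⟨⟨M, hM⟩, ⟨L, hL⟩, hd, hc, H, hH₀, hH⟩ ⟨⟨M', hM'⟩, ⟨L', hL'⟩, hd', hc', H', hH₀', hH'⟩
    refine ⟨⟨M + M', fun x => (abs_add_le _ _).trans (add_le_add (hM x) (hM' x))⟩,
      ⟨L + L', hL.add hL'⟩, fun x => (hd x).add (hd' x), hc.add hc', H + H', by positivity,
      fun x y => ?_⟩
    calc ‖p.2 x + q.2 x - (p.2 y + q.2 y)‖ = ‖(p.2 x - p.2 y) + (q.2 x - q.2 y)‖ := by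
          rw [add_sub_add_comm]
      _ ≤ H * ‖x - y‖ ^ α + H' * ‖x - y‖ ^ α := norm_add_le_of_le (hH x y) (hH' x y)
      _ = (H + H') * ‖x - y‖ ^ α := by ring
  smul_mem' := by
    rintro c p ⟨⟨M, hM⟩, ⟨L, hL⟩, hd, hc, H, hH₀, hH⟩
    refine ⟨⟨|c| * M, fun x => ?_⟩, ⟨‖c‖₊ * L, (lipschitzWith_smul c).comp hL⟩,
      fun x => (hd x).const_smul c, hc.const_smul c, |c| * H, by positivity, fun x y => ?_⟩
    · simpa [abs_mul] using mul_le_mul_of_nonneg_left (hM x) (abs_nonneg c)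
    · have hsub : c • p.2 x - c • p.2 y = c • (p.2 x - p.2 y) := (smul_sub c _ _).symm
      calc ‖c • p.2 x - c • p.2 y‖ = |c| * ‖p.2 x - p.2 y‖ := by
            rw [hsub, norm_smul, Real.norm_eq_abs]
        _ ≤ |c| * (H * ‖x - y‖ ^ α) := by gcongr; exact hH x y
        _ = |c| * H * ‖x - y‖ ^ α := by ring

/-- The space `C^{1,α}_b(Y)`, a type synonym of `c1aSubmodule` which carries the `C^{1,α}_b`-norm
instead of the topology of pointwise convergence. -/
def C1aSpace (Y : Type*) [NormedAddCommGroup Y] [NormedSpace ℝ Y] (α : ℝ) : Type _ :=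
  c1aSubmodule Y α

namespace C1aSpace

variable {α : ℝ}

instance : AddCommGroup (C1aSpace Y α) := inferInstanceAs (AddCommGroup (c1aSubmodule Y α))

instance : Module ℝ (C1aSpace Y α) := inferInstanceAs (Module ℝ (c1aSubmodule Y α))

/-- The inclusion of `C^{1,α}_b(Y)` into the space of pairs of maps. -/
def toPair : C1aSpace Y α →ₗ[ℝ] (Y → ℝ) × (Y → Y →L[ℝ] ℝ) := (c1aSubmodule Y α).subtype

theorem toPair_mem (p : C1aSpace Y α) : toPair p ∈ C1aSet α := p.2

theorem toPair_injective : Function.Injective (toPair : C1aSpace Y α → _) :=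
  Subtype.val_injective

theorem exists_toPair_eq {p : (Y → ℝ) × (Y → Y →L[ℝ] ℝ)} (hp : p ∈ C1aSet α) :
    ∃ q : C1aSpace Y α, toPair q = p := ⟨⟨p, hp⟩, rfl⟩

instance : Norm (C1aSpace Y α) := ⟨fun p => c1aNorm α (toPair p)⟩

theorem norm_def (p : C1aSpace Y α) : ‖p‖ = c1aNorm α (toPair p) := rfl

theorem c1aNorm_smul_le (c : ℝ) (p : C1aSpace Y α) : ‖c • p‖ ≤ |c| * ‖p‖ := by
  have hp := toPair_mem p
  refine c1aNorm_le (mul_nonneg (abs_nonneg c) (c1aNorm_nonneg _ _)) (fun x => ?_)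
    (fun x y => ?_) fun x y => ?_
  · simpa [norm_def, abs_mul] using mul_le_mul_of_nonneg_left (abs_le_c1aNorm hp x) (abs_nonneg c)
  · simpa [norm_def, ← mul_sub, abs_mul, mul_assoc] using
      mul_le_mul_of_nonneg_left (abs_sub_le_c1aNorm_mul hp x y) (abs_nonneg c)
  · have hsub : (toPair (c • p)).2 x - (toPair (c • p)).2 y
        = c • ((toPair p).2 x - (toPair p).2 y) := (smul_sub c _ _).symm
    rw [hsub, norm_smul, Real.norm_eq_abs, norm_def, mul_assoc]
    exact mul_le_mul_of_nonneg_left (norm_sub_le_c1aNorm_mul hp x y) (abs_nonneg c)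

theorem normedSpaceCore : NormedSpace.Core ℝ (C1aSpace Y α) where
  norm_nonneg p := c1aNorm_nonneg _ _
  norm_smul c p := by
    refine (c1aNorm_smul_le c p).antisymm ?_
    rcases eq_or_ne c 0 with rfl | hc
    · simpa [norm_def] using c1aNorm_nonneg α (toPair ((0 : ℝ) • p))
    · have h := c1aNorm_smul_le c⁻¹ (c • p)
      rw [inv_smul_smul₀ hc, abs_inv, inv_mul_eq_div, le_div_iff₀ (abs_pos.2 hc)] at h
      rwa [mul_comm, ← Real.norm_eq_abs] at h
  norm_triangle p q := by
    have hp := toPair_mem p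
    have hq := toPair_mem q
    refine c1aNorm_le (add_nonneg (c1aNorm_nonneg _ _) (c1aNorm_nonneg _ _)) (fun x => ?_)
      (fun x y => ?_) fun x y => ?_
    · simpa [norm_def] using (abs_add_le _ _).trans (add_le_add (abs_le_c1aNorm hp x) (abs_le_c1aNorm hq x))
    · simpa [norm_def, add_sub_add_comm, add_mul] using (abs_add_le _ _).trans
        (add_le_add (abs_sub_le_c1aNorm_mul hp x y) (abs_sub_le_c1aNorm_mul hq x y))
    · simpa [norm_def, add_sub_add_comm, add_mul] using
        norm_add_le_of_le (norm_sub_le_c1aNorm_mul hp x y) (norm_sub_le_c1aNorm_mul hq x y)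
  norm_eq_zero_iff p := by
    refine ⟨fun h => toPair_injective ?_, ?_⟩
    · rw [map_zero]
      refine Prod.ext (funext fun x => ?_) (funext fun x => ?_)
      · exact abs_nonpos_iff.1 ((abs_le_c1aNorm (toPair_mem p) x).trans_eq h)
      · exact norm_le_zero_iff.1 ((norm_deriv_le_c1aNorm (toPair_mem p) x).trans_eq h)
    · rintro rfl
      exact (c1aNorm_le le_rfl (by simp) (by simp) (by simp)).antisymm (c1aNorm_nonneg _ _)

instance : NormedAddCommGroup (C1aSpace Y α) := .ofCore normedSpaceCore

instance : NormedSpace ℝ (C1aSpace Y α) := .ofCore normedSpaceCore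

theorem dist_eq_d1a (p q : C1aSpace Y α) : dist p q = d1a α (toPair p) (toPair q) := by
  rw [dist_eq_norm, norm_def, map_sub, d1a_eq_c1aNorm_sub]

/-- Evaluation of a function at a point. -/
def evalAt (x : Y) : C1aSpace Y α →L[ℝ] ℝ :=
  LinearMap.mkContinuous (LinearMap.proj x ∘ₗ LinearMap.fst ℝ _ _ ∘ₗ toPair) 1 fun p => by
    simpa [norm_def] using abs_le_c1aNorm (toPair_mem p) x

/-- Evaluation of the differential at a point. -/
def derivAt (x : Y) : C1aSpace Y α →L[ℝ] Y →L[ℝ] ℝ :=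
  LinearMap.mkContinuous (LinearMap.proj x ∘ₗ LinearMap.snd ℝ _ _ ∘ₗ toPair) 1 fun p => by
    simpa [norm_def] using norm_deriv_le_c1aNorm (toPair_mem p) x

theorem evalAt_apply (x : Y) (p : C1aSpace Y α) : evalAt x p = (toPair p).1 x := rfl

theorem derivAt_apply (x : Y) (p : C1aSpace Y α) : derivAt x p = (toPair p).2 x := rfl

theorem abs_evalAt_le (x : Y) (p : C1aSpace Y α) : |evalAt x p| ≤ ‖p‖ :=
  abs_le_c1aNorm (toPair_mem p) x

theorem abs_evalAt_sub_le (x y : Y) (p : C1aSpace Y α) :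
    |evalAt x p - evalAt y p| ≤ ‖p‖ * ‖x - y‖ :=
  abs_sub_le_c1aNorm_mul (toPair_mem p) x y

theorem norm_derivAt_le (x : Y) (p : C1aSpace Y α) : ‖derivAt x p‖ ≤ ‖p‖ :=
  norm_deriv_le_c1aNorm (toPair_mem p) x

theorem norm_derivAt_sub_le (x y : Y) (p : C1aSpace Y α) :
    ‖derivAt x p - derivAt y p‖ ≤ ‖p‖ * ‖x - y‖ ^ α :=
  norm_sub_le_c1aNorm_mul (toPair_mem p) x y

theorem hasFDerivAt_evalAt (x : Y) (p : C1aSpace Y α) :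
    HasFDerivAt (fun y => evalAt y p) (derivAt x p) x :=
  (toPair_mem p).2.2.1 x

theorem continuous_derivAt (p : C1aSpace Y α) : Continuous fun x => derivAt x p :=
  (toPair_mem p).2.2.2.1

theorem exists_of_hasFDerivAt {g : Y → ℝ} {g' : Y → Y →L[ℝ] ℝ} {c : ℝ} (hc : 0 ≤ c)
    (h₀ : ∀ x, |g x| ≤ c) (h₁ : ∀ x y, |g x - g y| ≤ c * ‖x - y‖)
    (hd : ∀ x, HasFDerivAt g (g' x) x) (hcont : Continuous g')
    (h₂ : ∀ x y, ‖g' x - g' y‖ ≤ c * ‖x - y‖ ^ α) :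
    ∃ q : C1aSpace Y α, (∀ x, evalAt x q = g x) ∧ ∀ x, derivAt x q = g' x := by
  obtain ⟨q, hq⟩ := exists_toPair_eq (α := α) (p := (g, g')) ⟨⟨c, h₀⟩,
    ⟨⟨c, hc⟩, LipschitzWith.of_dist_le_mul fun x y => by
      rw [Real.dist_eq, dist_eq_norm]
      exact h₁ x y⟩, hd, hcont, c, hc, h₂⟩
  exact ⟨q, fun x => by rw [evalAt_apply, hq], fun x => by rw [derivAt_apply, hq]⟩

instance : CompleteSpace (C1aSpace Y α) := by
  refine Metric.complete_of_cauchySeq_tendsto fun u hu => ?_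
  choose g hg using fun x => cauchySeq_tendsto_of_complete
    ((evalAt x).uniformContinuous.comp_cauchySeq hu)
  choose g' hg' using fun x => cauchySeq_tendsto_of_complete
    ((derivAt x).uniformContinuous.comp_cauchySeq hu)
  obtain ⟨c, hc⟩ : ∃ c, ∀ n, ‖u n‖ ≤ c := by
    obtain ⟨c, -, hc⟩ := cauchySeq_bdd hu
    exact ⟨c + ‖u 0‖, fun n => by
      linarith [norm_le_norm_add_norm_sub' (u n) (u 0), dist_eq_norm (u n) (u 0), hc n 0]⟩
  have hc₀ : 0 ≤ c := (norm_nonneg _).trans (hc 0)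
  have hunif : TendstoUniformly (fun n x => derivAt x (u n)) g' atTop := by
    rw [Metric.tendstoUniformly_iff]
    intro ε hε
    obtain ⟨N, hN⟩ := Metric.cauchySeq_iff.1 hu (ε / 2) (half_pos hε)
    filter_upwards [eventually_ge_atTop N] with n hn x
    refine lt_of_le_of_lt ?_ (half_lt_self hε)
    refine le_of_tendsto ((hg' x).dist tendsto_const_nhds) ?_
    filter_upwards [eventually_ge_atTop N] with m hm
    calc dist (derivAt x (u m)) (derivAt x (u n)) = ‖derivAt x (u m - u n)‖ := by
          rw [map_sub, dist_eq_norm]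
      _ ≤ ‖u m - u n‖ := norm_derivAt_le _ _
      _ ≤ ε / 2 := by rw [← dist_eq_norm]; exact (hN m hm n hn).le
  obtain ⟨q, hq, hq'⟩ := exists_of_hasFDerivAt (α := α) hc₀
    (fun x => le_of_tendsto (hg x).abs (.of_forall fun n => (abs_evalAt_le _ _).trans (hc n)))
    (fun x y => le_of_tendsto ((hg x).sub (hg y)).abs (.of_forall fun n =>
      (abs_evalAt_sub_le _ _ _).trans (by gcongr; exact hc n)))
    (hasFDerivAt_of_tendstoUniformly hunif (fun n x => hasFDerivAt_evalAt x (u n)) hg)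
    (hunif.continuous (.of_forall fun n => continuous_derivAt (u n)))
    (fun x y => le_of_tendsto ((hg' x).sub (hg' y)).norm (.of_forall fun n =>
      (norm_derivAt_sub_le _ _ _).trans (by gcongr; exact hc n)))
  refine ⟨q, Metric.tendsto_atTop.2 fun ε hε => ?_⟩
  obtain ⟨N, hN⟩ := Metric.cauchySeq_iff.1 hu (ε / 2) (half_pos hε)
  refine ⟨N, fun n hn => lt_of_le_of_lt ?_ (half_lt_self hε)⟩
  have hle : ∀ᶠ m in atTop, ‖u n - u m‖ ≤ ε / 2 := by
    filter_upwards [eventually_ge_atTop N] with m hm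
    rw [← dist_eq_norm]
    exact (hN n hn m hm).le
  have heval : ∀ x, Tendsto (fun m => evalAt x (u n - u m)) atTop (𝓝 (evalAt x (u n - q))) := by
    intro x
    simp only [map_sub, hq]
    exact tendsto_const_nhds.sub (hg x)
  have hderiv : ∀ x,
      Tendsto (fun m => derivAt x (u n - u m)) atTop (𝓝 (derivAt x (u n - q))) := by
    intro x
    simp only [map_sub, hq']
    exact tendsto_const_nhds.sub (hg' x)
  rw [dist_eq_norm]
  refine c1aNorm_le (half_pos hε).le (fun x => ?_) (fun x y => ?_) fun x y => ?_
  · exact le_of_tendsto (heval x).abs (hle.mono fun m hm => (abs_evalAt_le _ _).trans hm)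
  · exact le_of_tendsto ((heval x).sub (heval y)).abs
      (hle.mono fun m hm => (abs_evalAt_sub_le _ _ _).trans (by gcongr))
  · exact le_of_tendsto ((hderiv x).sub (hderiv y)).norm
      (hle.mono fun m hm => (norm_derivAt_sub_le _ _ _).trans (by gcongr))

end C1aSpace

/-- A norm-compact convex set of functionals which does not contain `0` is strictly positive at
some vector. -/
theorem exists_forall_pos_of_isCompact_convex {A : Set (Y →L[ℝ] ℝ)} (hA : IsCompact A)
    (hconv : Convex ℝ A) (h0 : (0 : Y →L[ℝ] ℝ) ∉ A) : ∃ v : Y, ∀ a ∈ A, 0 < a v := by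
  let A' : Set (WeakBilin (topDualPairing ℝ Y)) := (StrongDual.toWeakDual : _ ≃ₗ[ℝ] _) '' A
  have hcomp : IsCompact A' := hA.image NormedSpace.Dual.toWeakDual_continuous
  have hconv' : Convex ℝ A' :=
    hconv.linear_image (StrongDual.toWeakDual (𝕜 := ℝ) (E := Y)).toLinearMap
  have h0' : (0 : WeakBilin (topDualPairing ℝ Y)) ∉ A' := fun ⟨a, ha, h⟩ =>
    h0 ((show a = 0 from h) ▸ ha)
  have : T2Space (WeakBilin (topDualPairing ℝ Y)) := inferInstanceAs (T2Space (WeakDual ℝ Y))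
  obtain ⟨F, u, hFu, hF⟩ := geometric_hahn_banach_point_closed hconv' hcomp.isClosed h0'
  obtain ⟨v, rfl⟩ := LinearMap.dualEmbedding_surjective (topDualPairing ℝ Y) F
  rw [map_zero] at hFu
  exact ⟨v, fun a ha => hFu.trans (hF _ (mem_image_of_mem _ ha))⟩

/-- If `f'` is not a nonpositive multiple of an element of `T`, then it can be made positive
simultaneously with the elements of `T`. -/
theorem exists_pos_and_forall_pos {T : Set (Y →L[ℝ] ℝ)} (hT : IsCompact T) (hconv : Convex ℝ T)
    (h0 : (0 : Y →L[ℝ] ℝ) ∉ T) {f' : Y →L[ℝ] ℝ} (hf' : f' ≠ 0)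
    (hmul : ∀ b : ℝ, 0 ≤ b → ∀ q ∈ T, f' + b • q ≠ 0) :
    ∃ v : Y, 0 < f' v ∧ ∀ q ∈ T, 0 < q v := by
  let A : Set (Y →L[ℝ] ℝ) := insert f' (convexJoin ℝ {f'} T)
  have hA : A = convexHull ℝ (insert f' T) := by
    rcases T.eq_empty_or_nonempty with rfl | hTne
    · simp [A]
    · rw [convexHull_insert hTne, hconv.convexHull_eq]
      exact insert_eq_of_mem (subset_convexJoin_left hTne rfl)
  have hcomp : IsCompact A := by
    refine IsCompact.insert ?_ f'
    have himg : convexJoin ℝ {f'} T =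
        (fun x : ℝ × (Y →L[ℝ] ℝ) => AffineMap.lineMap f' x.2 x.1) '' (Icc 0 1 ×ˢ T) := by
      ext g
      simp only [mem_convexJoin, mem_singleton_iff, exists_eq_left, segment_eq_image_lineMap,
        mem_image, Prod.exists, mem_prod]
      constructor
      · rintro ⟨q, hq, s, hs, rfl⟩
        exact ⟨s, q, ⟨hs, hq⟩, rfl⟩
      · rintro ⟨s, q, ⟨hs, hq⟩, rfl⟩
        exact ⟨q, hq, s, hs, rfl⟩
    rw [himg]
    refine (isCompact_Icc.prod hT).image ?_
    simp only [AffineMap.lineMap_apply_module]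
    fun_prop
  have h0A : (0 : Y →L[ℝ] ℝ) ∉ A := by
    rintro (h | h)
    · exact hf' h.symm
    · simp only [mem_convexJoin, mem_singleton_iff, exists_eq_left] at h
      obtain ⟨q, hq, s, t, hs, ht, hst, h⟩ := h
      rcases hs.eq_or_lt with rfl | hs
      · obtain rfl : t = 1 := by linarith
        rw [zero_smul, one_smul, zero_add] at h
        exact h0 (h ▸ hq)
      · refine hmul (t / s) (by positivity) q hq ?_
        have : f' + (t / s) • q = s⁻¹ • (s • f' + t • q) := by
          rw [smul_add, inv_smul_smul₀ hs.ne', smul_smul, inv_mul_eq_div]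
        rw [this, h, smul_zero]
  obtain ⟨v, hv⟩ := exists_forall_pos_of_isCompact_convex hcomp
    (hA ▸ convex_convexHull ℝ _) h0A
  exact ⟨v, hv f' (mem_insert _ _), fun q hq =>
    hv q (hA ▸ subset_convexHull ℝ _ (mem_insert_of_mem _ hq))⟩

/-- A Gateaux differentiable function with a directional maximum has nonpositive differential in
that direction. -/
theorem HasGateauxAt.apply_nonpos {f : Y → ℝ} {f' : Y →L[ℝ] ℝ} {x v : Y}
    (hf : HasGateauxAt f f' x) (hmax : ∀ᶠ t : ℝ in 𝓝[>] 0, f (x + t • v) ≤ f x) : f' v ≤ 0 := by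
  have h : 0 ≤ -f' v := by
    refine le_of_tendsto (hf v) ?_
    filter_upwards [hmax, self_mem_nhdsWithin] with t ht ht₀
    have ht₀ : 0 < t := ht₀
    rw [div_le_iff₀ ht₀]
    linarith
  linarith

namespace C1aSpace

variable {α : ℝ}

theorem exists_derivAt_apply_neg {p : C1aSpace Y α} {x v : Y} {t : ℝ} (ht : 0 < t)
    (h : evalAt (x + t • v) p < evalAt x p) : ∃ s ∈ Ioo 0 t, derivAt (x + s • v) p v < 0 := by
  have hd (s : ℝ) : HasDerivAt (fun s : ℝ => evalAt (x + s • v) p) (derivAt (x + s • v) p v) s := by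
    have hline : HasDerivAt (fun s : ℝ => x + s • v) v s := by
      simpa using ((hasDerivAt_id s).smul_const v).const_add x
    exact (hasFDerivAt_evalAt (x + s • v) p).comp_hasDerivAt s hline
  obtain ⟨s, hs, hslope⟩ := exists_hasDerivAt_eq_slope _ _ ht
    (fun s _ => (hd s).continuousAt.continuousWithinAt) fun s _ => hd s
  refine ⟨s, hs, hslope ▸ div_neg_of_neg_of_pos ?_ (by linarith)⟩
  simpa using h

/-- If every active constraint in the closure of a relatively compact family has positive
derivative in the direction `v`, then `v` is a feasible direction. -/
theorem eventually_forall_evalAt_nonneg (hα : 0 < α) {Q : Set (C1aSpace Y α)}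
    (hQ : IsCompact (closure Q)) {x v : Y} (hfeas : ∀ p ∈ Q, 0 ≤ evalAt x p)
    (hv : ∀ q ∈ closure Q, evalAt x q = 0 → 0 < derivAt x q v) :
    ∀ᶠ t : ℝ in 𝓝[>] 0, ∀ p ∈ Q, 0 ≤ evalAt (x + t • v) p := by
  by_contra hcon
  have hfreq : ∃ᶠ t : ℝ in 𝓝[>] 0, 0 < t ∧ ∃ p ∈ Q, evalAt (x + t • v) p < 0 := by
    rw [Filter.not_eventually] at hcon
    refine (hcon.and_eventually self_mem_nhdsWithin).mono fun t ht => ⟨ht.2, ?_⟩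
    simpa using ht.1
  obtain ⟨t, htlim, ht⟩ := Filter.exists_seq_forall_of_frequently hfreq
  choose ht₀ p hp hneg using ht
  choose s hs hsneg using fun n =>
    exists_derivAt_apply_neg (ht₀ n) ((hneg n).trans_le (hfeas _ (hp n)))
  obtain ⟨q, hq, σ, hσ, hlim⟩ := hQ.tendsto_subseq fun n => subset_closure (hp n)
  have ht0 : Tendsto (t ∘ σ) atTop (𝓝 0) :=
    (tendsto_nhds_of_tendsto_nhdsWithin htlim).comp hσ.tendsto_atTop
  have hs0 : Tendsto (s ∘ σ) atTop (𝓝 0) :=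
    squeeze_zero (fun n => (hs _).1.le) (fun n => (hs _).2.le) ht0
  have hdist {a : ℕ → ℝ} (ha : Tendsto a atTop (𝓝 0)) :
      Tendsto (fun n => ‖(x + a n • v) - x‖) atTop (𝓝 0) := by
    simpa using (ha.smul_const v).norm
  have hnorm : Tendsto (fun n => ‖p (σ n)‖) atTop (𝓝 ‖q‖) := hlim.norm
  have heval : Tendsto (fun n => evalAt x (p (σ n))) atTop (𝓝 (evalAt x q)) :=
    ((evalAt x).continuous.tendsto q).comp hlim
  have hderiv : Tendsto (fun n => derivAt x (p (σ n)) v) atTop (𝓝 (derivAt x q v)) :=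
    (((derivAt x).continuous.clm_apply continuous_const).tendsto q).comp hlim
  have hq0 : evalAt x q = 0 := by
    refine le_antisymm ?_ (ge_of_tendsto' heval fun n => hfeas _ (hp _))
    have hbound := hnorm.mul (hdist ht0)
    rw [mul_zero] at hbound
    refine le_of_tendsto_of_tendsto' heval hbound fun n => ?_
    have h := (abs_le.1 (abs_evalAt_sub_le (x + t (σ n) • v) x (p (σ n)))).1
    have h' := hneg (σ n)
    simp only [Function.comp_apply]
    linarith
  refine (hv q hq hq0).not_ge (le_of_tendsto_of_tendsto' hderiv (g := fun n =>
    ‖p (σ n)‖ * ‖(x + s (σ n) • v) - x‖ ^ α * ‖v‖) ?_ fun n => ?_)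
  · simpa [hα.ne'] using
      (hnorm.mul ((hdist hs0).rpow_const (p := α) (Or.inr hα.le))).mul_const ‖v‖
  · have h := (abs_le.1 (((derivAt (x + s (σ n) • v) (p (σ n)) - derivAt x (p (σ n))).le_opNorm
      v).trans (mul_le_mul_of_nonneg_right (norm_derivAt_sub_le _ _ _) (norm_nonneg v)))).1
    have h' := hsneg (σ n)
    rw [sub_apply] at h
    linarith

/-- Elements of the closed convex hull, in terms of sequences of pairs of maps. -/
theorem exists_seq_of_mem_closure_convexHull {P : Set ((Y → ℝ) × (Y → Y →L[ℝ] ℝ))}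
    {q : C1aSpace Y α} (hq : q ∈ closure (convexHull ℝ (toPair ⁻¹' P))) :
    ∃ u : ℕ → (Y → ℝ) × (Y → Y →L[ℝ] ℝ), (∀ n, u n ∈ convexHull ℝ P) ∧
      Tendsto (fun n => d1a α (u n) (toPair q)) atTop (𝓝 0) := by
  obtain ⟨w, hw, hlim⟩ := mem_closure_iff_seq_limit.1 hq
  refine ⟨fun n => toPair (w n), fun n => ?_, ?_⟩
  · have h := mem_image_of_mem (toPair (Y := Y) (α := α)) (hw n)
    rw [LinearMap.image_convexHull] at h
    exact convexHull_mono (image_preimage_subset _ _) h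
  · simpa only [dist_eq_d1a] using tendsto_iff_dist_tendsto_zero.1 hlim

end C1aSpace

/-- A subset of a metric space all of whose sequences have convergent subsequences is relatively
compact. -/
theorem isCompact_closure_of_forall_exists_subseq {X : Type*} [PseudoMetricSpace X] {Q : Set X}
    (hQ : ∀ u : ℕ → X, (∀ n, u n ∈ Q) →
      ∃ σ : ℕ → ℕ, StrictMono σ ∧ ∃ q, Tendsto (u ∘ σ) atTop (𝓝 q)) :
    IsCompact (closure Q) := by
  refine IsSeqCompact.isCompact fun v hv => ?_
  choose u hu hdist using fun n : ℕ =>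
    Metric.mem_closure_iff.1 (hv n) (1 / ((n : ℝ) + 1)) (by positivity)
  obtain ⟨σ, hσ, q, hq⟩ := hQ u hu
  refine ⟨q, mem_closure_of_tendsto hq (.of_forall fun n => hu _), σ, hσ, ?_⟩
  refine (tendsto_iff_of_dist ?_).2 hq
  exact squeeze_zero (fun _ => dist_nonneg) (fun n => (hdist (σ n)).le)
    (tendsto_one_div_add_atTop_nhds_zero_nat.comp hσ.tendsto_atTop)

open C1aSpace in
/-- Multiplier alternative for constraints in `C^{1,α}_b(Y)`: either `f'` vanishes, or some element
of the closed convex hull is active with vanishing differential, or a Lagrange multiplier rule with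
nonzero multiplier of `f'` holds. -/
theorem multiplier_alternative {α : ℝ} (hα : 0 < α) {Q : Set (C1aSpace Y α)}
    (hQ : IsCompact (closure Q)) {Ω : Set Y} (hΩ : IsOpen Ω) {x : Y} (hx : x ∈ Ω)
    {f : Y → ℝ} {f' : Y →L[ℝ] ℝ} (hf : HasGateauxAt f f' x)
    (hfeas : ∀ p ∈ Q, 0 ≤ evalAt x p)
    (hmax : ∀ y ∈ Ω, (∀ p ∈ Q, 0 ≤ evalAt y p) → f y ≤ f x) :
    f' = 0 ∨ ∃ q ∈ closure (convexHull ℝ Q), evalAt x q = 0 ∧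
      (derivAt x q = 0 ∨ ∃ b : ℝ, 0 ≤ b ∧ f' + b • derivAt x q = 0) := by
  by_contra! hcon
  obtain ⟨hf', hcon⟩ := hcon
  let K : Set (C1aSpace Y α) := closure (convexHull ℝ Q) ∩ {q | evalAt x q = 0}
  have hK : IsCompact K :=
    ((hQ.totallyBounded.subset subset_closure).convexHull.closure.isCompact_of_isClosed
      isClosed_closure).inter_right (isClosed_eq (evalAt x).continuous continuous_const)
  have hKconv : Convex ℝ K :=
    (convex_convexHull ℝ Q).closure.inter
      ((convex_singleton (0 : ℝ)).linear_preimage (evalAt x).toLinearMap)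
  obtain ⟨v, hfv, hv⟩ := exists_pos_and_forall_pos (hK.image (derivAt x).continuous)
    (hKconv.linear_image (derivAt x).toLinearMap)
    (by rintro ⟨q, hq, h⟩; exact (hcon q hq.1 hq.2).1 h) hf'
    (by rintro b hb _ ⟨q, hq, rfl⟩; exact (hcon q hq.1 hq.2).2 b hb)
  have hdir := eventually_forall_evalAt_nonneg hα hQ hfeas (v := v) fun q hq hq0 =>
    hv _ (mem_image_of_mem _ ⟨closure_mono (subset_convexHull ℝ Q) hq, hq0⟩)
  have hline : Tendsto (fun t : ℝ => x + t • v) (𝓝[>] 0) (𝓝 x) := by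
    have : Continuous fun t : ℝ => x + t • v := by fun_prop
    simpa using (this.tendsto 0).mono_left nhdsWithin_le_nhds
  refine hfv.not_ge (hf.apply_nonpos ?_)
  filter_upwards [hdir, hline (hΩ.mem_nhds hx)] with t ht htΩ
  exact hmax _ htΩ ht

/-- Let `C` (modelled as a set `P` of pairs) be a nonempty `C^{1,α}_b`-bounded,
relatively `‖·‖_{1,α}`-compact family, `Ω ⊆ Y` open, `f` Gateaux differentiable at `xh ∈ Ω`,
and suppose `xh` maximizes `f` over `{x ∈ Ω : φ(x) ≥ 0 ∀ φ ∈ C}`. Then either `d_Gf(xh) = 0`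
or there are `(λ*, β*) ∈ ℝ₊ × ℝ₊ \ {0}` and `ψ` in the `‖·‖_{1,α}`-closed convex hull of `C`
with `λ* d_Gf(xh) + β* ψ'(xh) = 0` and `ψ(xh) = 0`; if moreover
`0 ∉ {φ'(xh) : φ(xh) = 0, φ ∈ cch(C)}` one can take `λ* = 1`. -/
theorem lagrange_C1alpha [CompleteSpace Y]
    (α : ℝ) (hα0 : 0 < α) (hα1 : α ≤ 1)
    (P : Set ((Y → ℝ) × (Y → Y →L[ℝ] ℝ))) (hPne : P.Nonempty)
    (r : ℝ) (hr : 0 < r)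
    (hbd : ∀ p ∈ P, (∀ x : Y, |p.1 x| ≤ r) ∧ LipschitzWith (Real.toNNReal r) p.1 ∧
      (∀ x : Y, HasFDerivAt p.1 (p.2 x) x) ∧ Continuous p.2 ∧
      ∀ x₁ x₂ : Y, ‖p.2 x₁ - p.2 x₂‖ ≤ r * ‖x₁ - x₂‖ ^ α)
    (hrc : ∀ u : ℕ → (Y → ℝ) × (Y → Y →L[ℝ] ℝ), (∀ n, u n ∈ P) →
      ∃ σ : ℕ → ℕ, StrictMono σ ∧ ∃ q ∈ C1aSet α,
        Filter.Tendsto (fun n => d1a α (u (σ n)) q) Filter.atTop (𝓝 0))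
    (Ω : Set Y) (hΩ : IsOpen Ω) (xh : Y) (hxΩ : xh ∈ Ω)
    (f : Y → ℝ) (f' : Y →L[ℝ] ℝ) (hf : HasGateauxAt f f' xh)
    (hfeas : ∀ p ∈ P, 0 ≤ p.1 xh)
    (hmax : ∀ x ∈ Ω, (∀ p ∈ P, 0 ≤ p.1 x) → f x ≤ f xh) :
    (f' = 0 ∨
      ∃ l b : ℝ, 0 ≤ l ∧ 0 ≤ b ∧ (l, b) ≠ (0, 0) ∧
        ∃ ψ : (Y → ℝ) × (Y → Y →L[ℝ] ℝ), ψ ∈ C1aSet α ∧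
          (∃ u : ℕ → (Y → ℝ) × (Y → Y →L[ℝ] ℝ), (∀ n, u n ∈ convexHull ℝ P) ∧
            Filter.Tendsto (fun n => d1a α (u n) ψ) Filter.atTop (𝓝 0)) ∧
          ψ.1 xh = 0 ∧ l • f' + b • ψ.2 xh = 0) ∧
    ((0 : Y →L[ℝ] ℝ) ∉
        {q : Y →L[ℝ] ℝ | ∃ ψ : (Y → ℝ) × (Y → Y →L[ℝ] ℝ), ψ ∈ C1aSet α ∧
          (∃ u : ℕ → (Y → ℝ) × (Y → Y →L[ℝ] ℝ), (∀ n, u n ∈ convexHull ℝ P) ∧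
            Filter.Tendsto (fun n => d1a α (u n) ψ) Filter.atTop (𝓝 0)) ∧
          ψ.1 xh = 0 ∧ ψ.2 xh = q} →
      (f' = 0 ∨
        ∃ b : ℝ, 0 ≤ b ∧
          ∃ ψ : (Y → ℝ) × (Y → Y →L[ℝ] ℝ), ψ ∈ C1aSet α ∧
            (∃ u : ℕ → (Y → ℝ) × (Y → Y →L[ℝ] ℝ), (∀ n, u n ∈ convexHull ℝ P) ∧
              Filter.Tendsto (fun n => d1a α (u n) ψ) Filter.atTop (𝓝 0)) ∧
            ψ.1 xh = 0 ∧ f' + b • ψ.2 xh = 0)) := by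
  have hPC : P ⊆ C1aSet α := fun p hp => by
    obtain ⟨h₀, h₁, hd, hc, h₂⟩ := hbd p hp
    exact ⟨⟨r, h₀⟩, ⟨_, h₁⟩, hd, hc, r, hr.le, h₂⟩
  let Q : Set (C1aSpace Y α) := C1aSpace.toPair ⁻¹' P
  have hlift : ∀ p ∈ P, ∃ q ∈ Q, C1aSpace.toPair q = p := fun p hp => by
    obtain ⟨q, rfl⟩ := C1aSpace.exists_toPair_eq (hPC hp)
    exact ⟨q, hp, rfl⟩
  have hQ : IsCompact (closure Q) := by
    refine isCompact_closure_of_forall_exists_subseq fun u hu => ?_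
    obtain ⟨σ, hσ, q, hq, hlim⟩ := hrc (fun n => C1aSpace.toPair (u n)) hu
    obtain ⟨q, rfl⟩ := C1aSpace.exists_toPair_eq hq
    refine ⟨σ, hσ, q, tendsto_iff_dist_tendsto_zero.2 ?_⟩
    simpa only [C1aSpace.dist_eq_d1a, Function.comp_apply] using hlim
  have halt := multiplier_alternative hα0 hQ hΩ hxΩ hf (fun p hp => hfeas _ hp)
    fun y hy h => hmax y hy fun p hp => by
      obtain ⟨q, hq, rfl⟩ := hlift p hp
      exact h q hq
  rcases halt with hf' | ⟨q, hq, hq0, hmult⟩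
  · exact ⟨.inl hf', fun _ => .inl hf'⟩
  have hhull := C1aSpace.exists_seq_of_mem_closure_convexHull hq
  rcases hmult with hq' | ⟨b, hb, hmult⟩
  · refine ⟨.inr ⟨0, 1, le_rfl, zero_le_one, by simp, _, q.toPair_mem, hhull, hq0, ?_⟩,
      fun h => (h ⟨_, q.toPair_mem, hhull, hq0, hq'⟩).elim⟩
    rw [zero_smul, one_smul, zero_add]
    exact hq'
  · refine ⟨.inr ⟨1, b, zero_le_one, hb, by simp, _, q.toPair_mem, hhull, hq0, ?_⟩,
      fun _ => .inr ⟨b, hb, _, q.toPair_mem, hhull, hq0, hmult⟩⟩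
    rw [one_smul]
    exact hmult

end Stmt15
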